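/- arXiv:1105.1121 — 2 statements merged into one kernel-verified Lean document; each statement's English description precedes it below -/
import Mathlib

section
/- Let F_I : ℝ → ℝ be locally integrable with M := sup_{x∈ℝ} ∫_x^{x+1} |F_I(y)| dy < ∞. Then F(x,t) := ∫_ℝ G(t,z) F_I(x−z) dz is well defined (the integral converges absolutely) for every x ∈ ℝ and t > 0, F is infinitely differentiable on ℝ × (0,∞), and it satisfies the heat equation ∂_t F(x,t) = ∂_{xx} F(x,t) for all x ∈ ℝ, t > 0. -/
open MeasureTheory

/-- The one-dimensional heat kernel `G(t,x) = (4πt)^{-1/2} exp(−x²/(4t))`. -/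
noncomputable def heatKernel (t x : ℝ) : ℝ :=
  (Real.sqrt (4 * Real.pi * t))⁻¹ * Real.exp (-(x ^ 2) / (4 * t))

theorem hx_weight (x y : ℝ) : (1 + (x - y) ^ 2)⁻¹ ≤ 2 * (1 + x ^ 2) * (1 + y ^ 2)⁻¹ := by
  have h1 : 0 < 1 + (x - y) ^ 2 := by positivity
  have h2 : 0 < 1 + y ^ 2 := by positivity
  rw [← div_eq_mul_inv, inv_eq_one_div, div_le_div_iff₀ h1 h2]
  nlinarith [sq_nonneg (x * (x - y)), sq_nonneg (2 * x - y)]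

theorem hx_summable : Summable (fun n : ℤ => (1 + (n : ℝ) ^ 2)⁻¹) := by
  have h1 : Summable (fun n : ℤ => 1 / (n : ℝ) ^ 2) := Real.summable_one_div_int_pow.2 (by norm_num)
  have h2 : Summable (fun n : ℤ => if n = 0 then (1 : ℝ) else 0) := (hasSum_ite_eq 0 1).summable
  refine Summable.of_nonneg_of_le (fun n => by positivity) (fun n => ?_) (h1.add h2)
  by_cases hn : n = 0
  · simp [hn]
  · have : (0 : ℝ) < (n : ℝ) ^ 2 := by positivity
    simp only [hn, if_false, add_zero, one_div]
    gcongr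
    linarith

theorem hx_integrable (f : ℝ → ℝ) (hloc : LocallyIntegrable f volume)
    (M : ℝ) (hM : ∀ x : ℝ, (∫ y in x..(x + 1), |f y|) ≤ M) :
    Integrable (fun y => (1 + y ^ 2)⁻¹ * |f y|) := by
  have hcont : Continuous (fun y : ℝ => (1 + y ^ 2)⁻¹) :=
    Continuous.inv₀ (by fun_prop) (fun y => by positivity)
  have hI : ∀ a b : ℝ, IntegrableOn (fun y => |f y|) (Set.Ioc a b) := fun a b =>
    ((hloc.integrableOn_isCompact isCompact_Icc).mono_set Set.Ioc_subset_Icc_self).abs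
  have hI2 : ∀ a b : ℝ, IntegrableOn (fun y => (1 + y ^ 2)⁻¹ * |f y|) (Set.Ioc a b) := by
    intro a b
    refine Integrable.bdd_mul (c := 1) (hI a b) hcont.aestronglyMeasurable ?_
    filter_upwards with y
    rw [Real.norm_of_nonneg (by positivity)]
    apply inv_le_one_of_one_le₀
    nlinarith [sq_nonneg y]
  rw [← integrableOn_univ, ← iUnion_Ioc_intCast ℝ]
  refine integrableOn_iUnion_of_summable_integral_norm 
    (fun n => hI2 _ _) ?_
  refine Summable.of_nonneg_of_le (fun n => integral_nonneg fun y => norm_nonneg _) (fun n => ?_)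
    (hx_summable.mul_right (4 * M))
  have h0 : ∫ y in Set.Ioc (n : ℝ) (n + 1), |f y| ≤ M := by
    rw [← intervalIntegral.integral_of_le (by linarith)]
    exact hM n
  calc ∫ y in Set.Ioc (n : ℝ) (n + 1), ‖(1 + y ^ 2)⁻¹ * |f y|‖
      ≤ ∫ y in Set.Ioc (n : ℝ) (n + 1), (4 * (1 + (n : ℝ) ^ 2)⁻¹) * |f y| := by
        refine setIntegral_mono_on (hI2 _ _).norm ((hI _ _).const_mul _) measurableSet_Ioc ?_
        intro y hy
        rw [Real.norm_of_nonneg (by positivity)]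
        gcongr
        have := hx_weight (y - n) (-(n : ℝ))
        have e : y - (n : ℝ) - -(n : ℝ) = y := by ring
        rw [e, neg_sq] at this
        refine this.trans ?_
        gcongr
        nlinarith [hy.1, hy.2]
    _ = (4 * (1 + (n : ℝ) ^ 2)⁻¹) * ∫ y in Set.Ioc (n : ℝ) (n + 1), |f y| :=
        integral_const_mul _ _
    _ ≤ (4 * (1 + (n : ℝ) ^ 2)⁻¹) * M := by gcongr
    _ = _ := by ring

theorem hx_bound (k : ℕ) (R c : ℝ) (hc : 0 < c) :
    ∃ C : ℝ, 0 ≤ C ∧ ∀ x s y : ℝ, |x| ≤ R → c ≤ s →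
      |(x - y) ^ k * Real.exp (-s * (x - y) ^ 2)| ≤ C * (1 + y ^ 2)⁻¹ := by
  refine ⟨((k + 1).factorial * Real.exp c / c ^ (k + 1)) * (2 * (1 + R ^ 2)), by positivity, ?_⟩
  intro x s y hx hs
  set u := x - y with hu
  have h1 : |u ^ k| ≤ (1 + u ^ 2) ^ k := by
    rw [abs_pow]
    gcongr
    nlinarith [sq_nonneg (|u| - 1), sq_abs u, abs_nonneg u]
  have h2 := Real.pow_div_factorial_le_exp (x := c * (1 + u ^ 2)) (by positivity) (k + 1)
  have h3 : Real.exp (-s * u ^ 2) ≤ Real.exp (-c * u ^ 2) := by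
    apply Real.exp_le_exp.2
    nlinarith [sq_nonneg u]
  have h4 : (1 + u ^ 2) ^ (k + 1) * Real.exp (-c * u ^ 2)
      ≤ (k + 1).factorial * Real.exp c / c ^ (k + 1) := by
    rw [div_le_iff₀ (by positivity), mul_pow] at h2
    rw [le_div_iff₀ (by positivity)]
    have e : Real.exp (c * (1 + u ^ 2)) * Real.exp (-c * u ^ 2) = Real.exp c := by
      rw [← Real.exp_add]; congr 1; ring
    calc _ = (c ^ (k + 1) * (1 + u ^ 2) ^ (k + 1)) * Real.exp (-c * u ^ 2) := by ring
      _ ≤ (Real.exp (c * (1 + u ^ 2)) * (k + 1).factorial) * Real.exp (-c * u ^ 2) := by gcongr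
      _ = (k + 1).factorial * (Real.exp (c * (1 + u ^ 2)) * Real.exp (-c * u ^ 2)) := by ring
      _ = _ := by rw [e]
  have h5 : (1 + u ^ 2)⁻¹ ≤ 2 * (1 + R ^ 2) * (1 + y ^ 2)⁻¹ := by
    refine (hx_weight x y).trans ?_
    have : x ^ 2 ≤ R ^ 2 := sq_le_sq.2 (hx.trans (le_abs_self R))
    gcongr
  rw [abs_mul, abs_of_pos (Real.exp_pos _)]
  have hp : 0 < 1 + u ^ 2 := by positivity
  calc |u ^ k| * Real.exp (-s * u ^ 2) ≤ (1 + u ^ 2) ^ k * Real.exp (-c * u ^ 2) := by gcongr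
    _ = ((1 + u ^ 2) ^ (k + 1) * Real.exp (-c * u ^ 2)) * (1 + u ^ 2)⁻¹ := by
        field_simp
        ring
    _ ≤ ((k + 1).factorial * Real.exp c / c ^ (k + 1)) * (2 * (1 + R ^ 2) * (1 + y ^ 2)⁻¹) := by
        gcongr
    _ = _ := by ring

/-- the moment integrand -/
noncomputable def hxK (f : ℝ → ℝ) (k : ℕ) (p : ℝ × ℝ) (y : ℝ) : ℝ :=
  (p.1 - y) ^ k * Real.exp (-p.2 * (p.1 - y) ^ 2) * f y

/-- the moment integrals -/
noncomputable def hxJ (f : ℝ → ℝ) (k : ℕ) (p : ℝ × ℝ) : ℝ := ∫ y, hxK f k p y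

theorem hxK_meas (f : ℝ → ℝ) (hloc : LocallyIntegrable f volume) (k : ℕ) (p : ℝ × ℝ) :
    AEStronglyMeasurable (hxK f k p) volume := by
  unfold hxK
  refine AEStronglyMeasurable.mul ?_ hloc.aestronglyMeasurable
  exact Continuous.aestronglyMeasurable (by fun_prop)

theorem hxK_bound (f : ℝ → ℝ) (k : ℕ) (R c : ℝ) (hc : 0 < c) :
    ∃ C : ℝ, 0 ≤ C ∧ ∀ (p : ℝ × ℝ) (y : ℝ), |p.1| ≤ R → c ≤ p.2 →
      |hxK f k p y| ≤ C * ((1 + y ^ 2)⁻¹ * |f y|) := by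
  obtain ⟨C, hC, h⟩ := hx_bound k R c hc
  refine ⟨C, hC, fun p y h1 h2 => ?_⟩
  unfold hxK
  rw [abs_mul, ← mul_assoc]
  exact mul_le_mul_of_nonneg_right (h _ _ _ h1 h2) (abs_nonneg _)

theorem hxK_integrable (f : ℝ → ℝ) (hloc : LocallyIntegrable f volume)
    (hf : Integrable (fun y => (1 + y ^ 2)⁻¹ * |f y|)) (k : ℕ) (p : ℝ × ℝ) (hp : 0 < p.2) :
    Integrable (hxK f k p) := by
  obtain ⟨C, hC, h⟩ := hxK_bound f k |p.1| p.2 hp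
  refine (hf.const_mul C).mono' (hxK_meas f hloc k p) ?_
  filter_upwards with y
  exact h p y le_rfl le_rfl

theorem hxK_hasFDerivAt (f : ℝ → ℝ) (k : ℕ) (p : ℝ × ℝ) (y : ℝ) :
    HasFDerivAt (fun p => hxK f k p y)
      ((k * hxK f (k - 1) p y - 2 * p.2 * hxK f (k + 1) p y) • ContinuousLinearMap.fst ℝ ℝ ℝ
        + (-hxK f (k + 2) p y) • ContinuousLinearMap.snd ℝ ℝ ℝ) p := by
  have h1 : HasFDerivAt (fun p : ℝ × ℝ => p.1 - y) (ContinuousLinearMap.fst ℝ ℝ ℝ) p :=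
    hasFDerivAt_fst.sub_const y
  have h2 : HasFDerivAt (fun p : ℝ × ℝ => -p.2) (-ContinuousLinearMap.snd ℝ ℝ ℝ) p :=
    hasFDerivAt_snd.neg
  have h3 := (((h1.pow k).mul (h2.mul (h1.pow 2)).exp).mul_const (f y))
  unfold hxK
  refine h3.congr_fderiv ?_
  ext <;> simp <;> ring

theorem hxJ_hasFDerivAt (f : ℝ → ℝ) (hloc : LocallyIntegrable f volume)
    (hf : Integrable (fun y => (1 + y ^ 2)⁻¹ * |f y|)) (k : ℕ) (p : ℝ × ℝ) (hp : 0 < p.2) :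
    HasFDerivAt (hxJ f k)
      ((k * hxJ f (k - 1) p - 2 * p.2 * hxJ f (k + 1) p) • ContinuousLinearMap.fst ℝ ℝ ℝ
        + (-hxJ f (k + 2) p) • ContinuousLinearMap.snd ℝ ℝ ℝ) p := by
  have hi := hxK_integrable f hloc hf
  obtain ⟨C1, hC1, b1⟩ := hxK_bound f (k - 1) (|p.1| + 1) (p.2 / 2) (by linarith)
  obtain ⟨C2, hC2, b2⟩ := hxK_bound f (k + 1) (|p.1| + 1) (p.2 / 2) (by linarith)
  obtain ⟨C3, hC3, b3⟩ := hxK_bound f (k + 2) (|p.1| + 1) (p.2 / 2) (by linarith)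
  let S : Set (ℝ × ℝ) := {q | |q.1| < |p.1| + 1 ∧ p.2 / 2 < q.2 ∧ q.2 < p.2 + 1}
  have hS : S ∈ nhds p := by
    refine IsOpen.mem_nhds ?_ ⟨by linarith, by linarith, by linarith⟩
    have o1 : IsOpen {q : ℝ × ℝ | |q.1| < |p.1| + 1} := isOpen_lt (by fun_prop) (by fun_prop)
    have o2 : IsOpen {q : ℝ × ℝ | p.2 / 2 < q.2} := isOpen_lt (by fun_prop) (by fun_prop)
    have o3 : IsOpen {q : ℝ × ℝ | q.2 < p.2 + 1} := isOpen_lt (by fun_prop) (by fun_prop)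
    exact o1.inter (o2.inter o3)
  have hA : Integrable (fun y => k * hxK f (k - 1) p y - 2 * p.2 * hxK f (k + 1) p y) :=
    ((hi _ p hp).const_mul _).sub ((hi _ p hp).const_mul _)
  have hB : Integrable (fun y => -hxK f (k + 2) p y) := (hi _ p hp).neg
  have key := hasFDerivAt_integral_of_dominated_of_fderiv_le (𝕜 := ℝ) (μ := volume)
    (F := fun p y => hxK f k p y) (x₀ := p) (s := S)
    (F' := fun p y =>
      (k * hxK f (k - 1) p y - 2 * p.2 * hxK f (k + 1) p y) • ContinuousLinearMap.fst ℝ ℝ ℝ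
        + (-hxK f (k + 2) p y) • ContinuousLinearMap.snd ℝ ℝ ℝ)
    (bound := fun y => (k * C1 + 2 * (p.2 + 1) * C2 + C3) * ((1 + y ^ 2)⁻¹ * |f y|))
    hS (Filter.Eventually.of_forall fun q => hxK_meas f hloc k q) (hi k p hp)
    ((hA.smul_const (ContinuousLinearMap.fst ℝ ℝ ℝ)).aestronglyMeasurable.add
      (hB.smul_const (ContinuousLinearMap.snd ℝ ℝ ℝ)).aestronglyMeasurable) ?_ (hf.const_mul _)
    (Filter.Eventually.of_forall fun y q _ => hxK_hasFDerivAt f k q y)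
  · rw [integral_add (hA.smul_const _) (hB.smul_const _), integral_smul_const,
      integral_smul_const, integral_sub ((hi _ p hp).const_mul _) ((hi _ p hp).const_mul _),
      integral_const_mul, integral_const_mul, integral_neg] at key
    exact key
  · refine Filter.Eventually.of_forall fun y q hq => ?_
    have hq2 : 0 < q.2 := by linarith [hq.2.1]
    have c1 := b1 q y hq.1.le hq.2.1.le
    have c2 := b2 q y hq.1.le hq.2.1.le
    have c3 := b3 q y hq.1.le hq.2.1.le
    set W := (1 + y ^ 2)⁻¹ * |f y| with hW
    have n1 : |(k : ℝ) * hxK f (k - 1) q y - 2 * q.2 * hxK f (k + 1) q y|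
        ≤ k * (C1 * W) + 2 * (p.2 + 1) * (C2 * W) := by
      refine (abs_sub _ _).trans ?_
      rw [abs_mul, abs_mul, abs_of_nonneg (Nat.cast_nonneg k),
        abs_of_pos (by linarith : 0 < 2 * q.2)]
      have := hq.2.2
      gcongr
    refine (norm_add_le _ _).trans ?_
    rw [norm_smul, norm_smul, Real.norm_eq_abs, Real.norm_eq_abs, abs_neg]
    have e1 := ContinuousLinearMap.norm_fst_le ℝ ℝ ℝ
    have e2 := ContinuousLinearMap.norm_snd_le ℝ ℝ ℝ
    have := mul_le_mul_of_nonneg_left e1 (abs_nonneg ((k : ℝ) * hxK f (k - 1) q y - 2 * q.2 * hxK f (k + 1) q y))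
    have := mul_le_mul_of_nonneg_left e2 (abs_nonneg (hxK f (k + 2) q y))
    nlinarith

theorem hxJ_contDiffOn (f : ℝ → ℝ) (hloc : LocallyIntegrable f volume)
    (hf : Integrable (fun y => (1 + y ^ 2)⁻¹ * |f y|)) (n : ℕ) : ∀ k : ℕ,
    ContDiffOn ℝ n (hxJ f k) (Set.univ ×ˢ Set.Ioi (0 : ℝ)) := by
  have ho : IsOpen ((Set.univ : Set ℝ) ×ˢ Set.Ioi (0 : ℝ)) := isOpen_univ.prod isOpen_Ioi
  induction n with
  | zero =>
    intro k
    rw [Nat.cast_zero, contDiffOn_zero]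
    intro p hp
    exact (hxJ_hasFDerivAt f hloc hf k p hp.2).continuousAt.continuousWithinAt
  | succ n ih =>
    intro k
    rw [Nat.cast_succ, contDiffOn_succ_iff_hasFDerivWithinAt_of_uniqueDiffOn ho.uniqueDiffOn]
    refine ⟨by simp, fun p =>
      (k * hxJ f (k - 1) p - 2 * p.2 * hxJ f (k + 1) p) • ContinuousLinearMap.fst ℝ ℝ ℝ
        + (-hxJ f (k + 2) p) • ContinuousLinearMap.snd ℝ ℝ ℝ, ?_, fun p hp => (hxJ_hasFDerivAt f hloc hf k p hp.2).hasFDerivWithinAt⟩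
    refine ContDiffOn.add ?_ ?_
    · have h2 : ContDiffOn ℝ n (fun p : ℝ × ℝ => 2 * p.2) (Set.univ ×ˢ Set.Ioi (0 : ℝ)) :=
        ContDiff.contDiffOn (by fun_prop)
      have h3 : ContDiffOn ℝ n (fun p : ℝ × ℝ => k * hxJ f (k - 1) p
          - 2 * p.2 * hxJ f (k + 1) p) (Set.univ ×ˢ Set.Ioi (0 : ℝ)) :=
        ContDiffOn.sub (ContDiffOn.mul contDiffOn_const (ih _)) (ContDiffOn.mul h2 (ih _))
      exact h3.smul contDiffOn_const
    · exact ContDiffOn.smul (ih _).neg contDiffOn_const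

theorem hx_kernel (f : ℝ → ℝ) (x t z : ℝ) :
    heatKernel t z * f (x - z)
      = (Real.sqrt (4 * Real.pi * t))⁻¹ * hxK f 0 (x, (4 * t)⁻¹) (x - z) := by
  unfold heatKernel hxK
  have : -(z ^ 2) / (4 * t) = -(4 * t)⁻¹ * (x - (x - z)) ^ 2 := by
    rw [div_eq_mul_inv]; ring
  simp only [this]
  ring

/-- If `F_I` is locally integrable with uniformly bounded unit-interval averages, then the
heat extension `F(x,t) = ∫ G(t,z) F_I(x−z) dz` is well defined (absolutely convergent) for
all `x ∈ ℝ`, `t > 0`, is infinitely differentiable on `ℝ × (0,∞)`, and satisfies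
`∂ₜ F = ∂ₓₓ F` there. -/
theorem heat_extension_smooth_and_solves_heat_equation
    (F_I : ℝ → ℝ) (hloc : LocallyIntegrable F_I volume)
    (M : ℝ) (hM : ∀ x : ℝ, (∫ y in x..(x + 1), |F_I y|) ≤ M)
    (F : ℝ → ℝ → ℝ)
    (hF : ∀ x t : ℝ, F x t = ∫ z : ℝ, heatKernel t z * F_I (x - z)) :
    (∀ x : ℝ, ∀ t : ℝ, 0 < t → Integrable (fun z : ℝ => heatKernel t z * F_I (x - z))) ∧
    ContDiffOn ℝ (⊤ : ℕ∞) (fun p : ℝ × ℝ => F p.1 p.2) (Set.univ ×ˢ Set.Ioi (0 : ℝ)) ∧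
    (∀ x : ℝ, ∀ t : ℝ, 0 < t →
      deriv (fun s : ℝ => F x s) t = deriv (deriv (fun y : ℝ => F y t)) x) := by
  have hf := hx_integrable F_I hloc M hM
  have hFJ : ∀ x t : ℝ, F x t = (Real.sqrt (4 * Real.pi * t))⁻¹ * hxJ F_I 0 (x, (4 * t)⁻¹) := by
    intro x t
    rw [hF]
    simp_rw [hx_kernel]
    rw [integral_const_mul, integral_sub_left_eq_self (fun y => hxK F_I 0 (x, (4 * t)⁻¹) y)]
    rfl
  refine ⟨?_, ?_, ?_⟩
  · intro x t ht
    simp_rw [hx_kernel]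
    refine Integrable.const_mul ?_ _
    have := hxK_integrable F_I hloc hf 0 (x, (4 * t)⁻¹) (by positivity)
    exact this.comp_sub_left x
  · simp_rw [hFJ]
    refine contDiffOn_infty.2 fun n => ?_
    refine ContDiffOn.mul ?_ ?_
    · have hne : ∀ p ∈ (Set.univ : Set ℝ) ×ˢ Set.Ioi (0 : ℝ), 4 * Real.pi * p.2 ≠ 0 := by
        rintro p ⟨-, hp⟩
        have : 0 < p.2 := hp
        positivity
      refine ContDiffOn.inv (ContDiffOn.sqrt (ContDiff.contDiffOn (by fun_prop)) hne) ?_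
      rintro p ⟨-, hp⟩
      have : 0 < p.2 := hp
      positivity
    · refine (hxJ_contDiffOn F_I hloc hf n 0).comp
        (g := hxJ F_I 0) (f := fun p : ℝ × ℝ => (p.1, (4 * p.2)⁻¹)) ?_ ?_
      · refine contDiffOn_fst.prodMk (ContDiffOn.inv (ContDiff.contDiffOn (by fun_prop)) ?_)
        rintro p ⟨-, hp⟩
        have : 0 < p.2 := hp
        positivity
      · rintro p ⟨-, hp⟩
        have : 0 < p.2 := hp
        refine ⟨trivial, ?_⟩
        show 0 < (4 * p.2)⁻¹
        positivity
  · intro x t ht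
    have hs : 0 < (4 * t)⁻¹ := by positivity
    have dx : ∀ (k : ℕ) (y : ℝ), HasDerivAt (fun y => hxJ F_I k (y, (4 * t)⁻¹))
        (k * hxJ F_I (k - 1) (y, (4 * t)⁻¹)
          - 2 * (4 * t)⁻¹ * hxJ F_I (k + 1) (y, (4 * t)⁻¹)) y := by
      intro k y
      have h := (hxJ_hasFDerivAt F_I hloc hf k (y, (4 * t)⁻¹) hs).comp_hasDerivAt y
        ((hasDerivAt_id y).prodMk (hasDerivAt_const y ((4 * t)⁻¹)))
      refine h.congr_deriv ?_
      simp
    have dinv : HasDerivAt (fun s : ℝ => (4 * s)⁻¹) (-4 / (4 * t) ^ 2) t := by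
      have := ((hasDerivAt_id t).const_mul 4).inv (by simp; positivity)
      refine HasDerivAt.congr_deriv this ?_
      simp
    have dt : HasDerivAt (fun s => hxJ F_I 0 (x, (4 * s)⁻¹))
        (-hxJ F_I 2 (x, (4 * t)⁻¹) * (-4 / (4 * t) ^ 2)) t := by
      have h := (hxJ_hasFDerivAt F_I hloc hf 0 (x, (4 * t)⁻¹) hs).comp_hasDerivAt t
        ((hasDerivAt_const t x).prodMk dinv)
      refine h.congr_deriv ?_
      simp
    have dP : HasDerivAt (fun s : ℝ => (Real.sqrt (4 * Real.pi * s))⁻¹)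
        (-(1 / (2 * t)) * (Real.sqrt (4 * Real.pi * t))⁻¹) t := by
      have hpos : 0 < 4 * Real.pi * t := by positivity
      have h1 : HasDerivAt (fun s : ℝ => 4 * Real.pi * s) (4 * Real.pi) t := by
        simpa using (hasDerivAt_id t).const_mul (4 * Real.pi)
      have h2 := (h1.sqrt hpos.ne').inv (Real.sqrt_pos.2 hpos).ne'
      refine h2.congr_deriv ?_
      have hsq := Real.sq_sqrt hpos.le
      have hr := Real.sqrt_pos.2 hpos
      rw [hsq]
      field_simp
    have hx1 : deriv (fun y : ℝ => F y t) = fun y => (Real.sqrt (4 * Real.pi * t))⁻¹ *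
        (-(2 * (4 * t)⁻¹) * hxJ F_I 1 (y, (4 * t)⁻¹)) := by
      funext y
      simp_rw [hFJ]
      refine (((dx 0 y).const_mul _).congr_deriv ?_).deriv
      simp
    rw [hx1]
    have hx2 := (((dx 1 x).const_mul (-(2 * (4 * t)⁻¹))).const_mul
      (Real.sqrt (4 * Real.pi * t))⁻¹).deriv
    rw [hx2]
    simp_rw [hFJ]
    refine (HasDerivAt.deriv (dP.mul dt)).trans ?_
    norm_num
    field_simp
    ring
end

section
/- Let f_I ∈ L¹(ℝ) ∩ L^∞(ℝ) satisfy (A1) with price p0 ∈ ℝ and transaction cost a > 0, let F_I be the transformed datum and F(x,t) := ∫_ℝ G(t,z) F_I(x−z) dz its heat extension. Then for every t > 0 there exists exactly one point x = p(t) ∈ ℝ with F(p(t),t) = 0; the resulting function p : (0,∞) → ℝ is continuous, and p(t) → p0 as t → 0+. -/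
open MeasureTheory

open Filter Topology Set

namespace FB

lemma series_facts (f : ℝ → ℝ) (hf : AEMeasurable f) (B : ℝ) (hB : ∀ x, |f x| ≤ B)
    (p a : ℝ) (ha : 0 < a) (hle : ∀ x, p ≤ x → f x ≤ 0) :
    AEMeasurable (fun x => ∑' n : ℕ, max (f (x + n * a)) 0) ∧
    (∀ x, |∑' n : ℕ, max (f (x + n * a)) 0| ≤ B * (1 + |x - p| / a)) ∧
    (∀ x, p ≤ x → ∑' n : ℕ, max (f (x + n * a)) 0 = 0) ∧
    (∀ x, 0 < f x → 0 < ∑' n : ℕ, max (f (x + n * a)) 0) := by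
  have hB0 : 0 ≤ B := (abs_nonneg _).trans (hB 0)
  have hz : ∀ x : ℝ, ∀ n : ℕ, n ∉ Finset.range ⌈|x - p| / a⌉₊ → max (f (x + n * a)) 0 = 0 := by
    intro x n hn
    have h1 : ⌈|x - p| / a⌉₊ ≤ n := by simpa using hn
    have h2 : |x - p| / a ≤ n := Nat.ceil_le.mp h1
    rw [div_le_iff₀ ha] at h2
    apply max_eq_right
    apply hle
    have := neg_abs_le (x - p)
    linarith
  have hsum : ∀ x : ℝ, Summable (fun n : ℕ => max (f (x + n * a)) 0) := fun x =>
    summable_of_ne_finset_zero (hz x)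
  refine ⟨?_, ?_, ?_, ?_⟩
  · apply aemeasurable_of_tendsto_metrizable_ae (u := atTop)
      (f := fun N : ℕ => fun x => ∑ n ∈ Finset.range N, max (f (x + n * a)) 0)
    · intro N
      apply Finset.aemeasurable_fun_sum
      intro n _
      have : AEMeasurable (fun x => f (x + n * a)) :=
        hf.comp_quasiMeasurePreserving (measurePreserving_add_right volume _).quasiMeasurePreserving
      exact this.max aemeasurable_const
    · exact ae_of_all _ fun x => (hsum x).hasSum.tendsto_sum_nat
  · intro x
    rw [abs_of_nonneg (tsum_nonneg fun n => le_max_right _ _), tsum_eq_sum (hz x)]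
    calc _ ≤ ∑ n ∈ Finset.range ⌈|x - p| / a⌉₊, B := by
          apply Finset.sum_le_sum
          intro n _
          exact max_le ((le_abs_self _).trans (hB _)) hB0
      _ = B * ⌈|x - p| / a⌉₊ := by simp [mul_comm]
      _ ≤ _ := by
          have := (Nat.ceil_lt_add_one (div_nonneg (abs_nonneg (x - p)) ha.le)).le
          gcongr
          linarith
  · intro x hx
    have : ∀ n : ℕ, max (f (x + n * a)) 0 = 0 := fun n => by
      apply max_eq_right
      apply hle
      have : 0 ≤ n * a := by positivity
      linarith
    simp [this]
  · intro x hx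
    apply (hsum x).tsum_pos (fun n => le_max_right _ _) 0
    simpa using hx

/-- unnormalized heat extension -/
noncomputable def H (g : ℝ → ℝ) (s t : ℝ) : ℝ := ∫ w, Real.exp (-((s - w) ^ 2) / (4 * t)) * g w

structure Good (g : ℝ → ℝ) (C : ℝ) : Prop where
  meas : AEStronglyMeasurable g
  bd : ∀ w, |g w| ≤ C * (1 + |w|)
  pos : ∀ w, w < 0 → 0 < g w
  neg : ∀ w, 0 < w → g w < 0

variable {g : ℝ → ℝ} {C : ℝ}

lemma Good.refl (hg : Good g C) : Good (fun w => -g (-w)) C := by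
  refine ⟨?_, ?_, ?_, ?_⟩
  · exact (hg.meas.comp_quasiMeasurePreserving
      (Measure.measurePreserving_neg volume).quasiMeasurePreserving).neg
  · intro w
    simpa using hg.bd (-w)
  · intro w hw
    have := hg.neg (-w) (by linarith)
    simpa using this
  · intro w hw
    have := hg.pos (-w) (by linarith)
    simpa using this

lemma H_refl (g : ℝ → ℝ) (s t : ℝ) : H (fun w => -g (-w)) s t = - H g (-s) t := by
  unfold H
  rw [← integral_neg, ← integral_neg_eq_self]
  congr 1
  ext w
  have : (s - -w) ^ 2 = (-s - w) ^ 2 := by ring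
  rw [this]
  simp

lemma int_bd (C b : ℝ) (hb : 0 < b) :
    Integrable (fun w : ℝ => Real.exp (-b * w ^ 2) * (C * (1 + |w|))) := by
  have h1 := (integrable_exp_neg_mul_sq hb).const_mul C
  have h2 := (integrable_mul_exp_neg_mul_sq hb).abs.const_mul C
  refine (h1.add h2).congr (ae_of_all _ fun w => ?_)
  simp [abs_mul]
  ring

lemma ker_bd (s t w S T : ℝ) (ht : 0 < t) (hT : t ≤ T) (hs : |s| ≤ S) :
    Real.exp (-((s - w) ^ 2) / (4 * t)) ≤
      Real.exp (S ^ 2 / (4 * T)) * Real.exp (-(1 / (8 * T)) * w ^ 2) := by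
  have hT0 : 0 < T := ht.trans_le hT
  rw [← Real.exp_add, Real.exp_le_exp]
  have h1 : (s - w) ^ 2 / (4 * T) ≤ (s - w) ^ 2 / (4 * t) := by gcongr
  have h2 : s ^ 2 ≤ S ^ 2 := sq_le_sq' (by linarith [neg_abs_le s]) (by linarith [le_abs_self s])
  have h3 : -(1 / (8 * T)) * w ^ 2 = (- (w ^ 2 / 2)) / (4 * T) := by field_simp; ring
  have h4 : -((s - w) ^ 2) / (4 * T) ≤ (S ^ 2 + - (w ^ 2 / 2)) / (4 * T) := by
    gcongr
    nlinarith [sq_nonneg (2 * s - w)]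
  rw [h3, ← add_div]
  rw [neg_div] at *
  linarith

lemma Good.int (hg : Good g C) (s t : ℝ) (ht : 0 < t) :
    Integrable (fun w => Real.exp (-((s - w) ^ 2) / (4 * t)) * g w) := by
  refine ((int_bd C (1 / (8 * t)) (by positivity)).const_mul
    (Real.exp (|s| ^ 2 / (4 * t)))).mono' ?_ (ae_of_all _ fun w => ?_)
  · exact (Continuous.aestronglyMeasurable (by fun_prop)).mul hg.meas
  · rw [norm_mul, Real.norm_eq_abs, Real.norm_eq_abs, Real.abs_exp, ← mul_assoc]
    exact mul_le_mul (ker_bd s t w |s| t ht le_rfl le_rfl) (hg.bd w) (abs_nonneg _) (by positivity)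

lemma Good.cont (hg : Good g C) (s t : ℝ) (ht : 0 < t) :
    ContinuousAt (fun q : ℝ × ℝ => H g q.1 q.2) (s, t) := by
  unfold H
  have hev : ∀ᶠ q : ℝ × ℝ in 𝓝 (s, t), 0 < q.2 ∧ q.2 ≤ t + 1 ∧ |q.1| ≤ |s| + 1 := by
    have h1 : ∀ᶠ q : ℝ × ℝ in 𝓝 (s, t), 0 < q.2 :=
      continuousAt_snd.eventually (lt_mem_nhds ht)
    have h2 : ∀ᶠ q : ℝ × ℝ in 𝓝 (s, t), q.2 < t + 1 :=
      continuousAt_snd.eventually (gt_mem_nhds (by simp))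
    have h3 : ∀ᶠ q : ℝ × ℝ in 𝓝 (s, t), |q.1| < |s| + 1 :=
      (continuousAt_fst.abs).eventually (gt_mem_nhds (by simp))
    filter_upwards [h1, h2, h3] with q a b c using ⟨a, b.le, c.le⟩
  refine continuousAt_of_dominated (bound := fun w => Real.exp ((|s| + 1) ^ 2 / (4 * (t + 1))) *
    (Real.exp (-(1 / (8 * (t + 1))) * w ^ 2) * (C * (1 + |w|)))) ?_ ?_ ?_ ?_
  · filter_upwards [hev] with q hq
    exact (hg.int q.1 q.2 hq.1).1
  · filter_upwards [hev] with q hq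
    refine ae_of_all _ fun w => ?_
    rw [norm_mul, Real.norm_eq_abs, Real.norm_eq_abs, Real.abs_exp, ← mul_assoc]
    exact mul_le_mul (ker_bd _ _ w _ _ hq.1 hq.2.1 hq.2.2) (hg.bd w) (abs_nonneg _) (by positivity)
  · exact (int_bd C _ (by positivity)).const_mul _
  · refine ae_of_all _ fun w => ?_
    have : 4 * t ≠ 0 := by positivity
    refine ContinuousAt.mul (ContinuousAt.rexp (ContinuousAt.div ?_ ?_ this)) continuousAt_const
    · fun_prop
    · fun_prop

lemma pos_of_ae (k : ℝ → ℝ) (hk : Integrable k) (h : ∀ w, w ≠ 0 → 0 < k w) : 0 < ∫ w, k w := by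
  have hae : ∀ᵐ w : ℝ, w ≠ 0 := by simp [ae_iff]
  rw [integral_pos_iff_support_of_nonneg_ae (by filter_upwards [hae] with w hw using (h w hw).le) hk]
  refine lt_of_lt_of_le ?_ (measure_mono (s := Ioo (1:ℝ) 2) ?_)
  · simp
  · intro w hw
    exact (h w (by linarith [hw.1])).ne'


lemma ker_split (s t w : ℝ) (ht : 0 < t) :
    Real.exp (s ^ 2 / (4 * t)) * Real.exp (-((s - w) ^ 2) / (4 * t)) =
      Real.exp (s * w / (2 * t)) * Real.exp (-(w ^ 2) / (4 * t)) := by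
  rw [← Real.exp_add, ← Real.exp_add]
  congr 1
  field_simp
  ring

lemma Good.anti (hg : Good g C) (t : ℝ) (ht : 0 < t) :
    StrictAnti (fun s => Real.exp (s ^ 2 / (4 * t)) * H g s t) := by
  intro s r hsr
  have hi : ∀ s, Integrable fun w => Real.exp (s ^ 2 / (4 * t)) *
      (Real.exp (-((s - w) ^ 2) / (4 * t)) * g w) := fun s => (hg.int s t ht).const_mul _
  simp only [H, ← integral_const_mul]
  rw [← sub_pos, ← integral_sub (hi _) (hi _)]
  refine pos_of_ae _ ((hi _).sub (hi _)) fun w hw => ?_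
  rw [← mul_assoc, ← mul_assoc, ker_split _ _ _ ht, ker_split _ _ _ ht]
  have he : 0 < Real.exp (-(w ^ 2) / (4 * t)) := Real.exp_pos _
  have : 0 < (Real.exp (s * w / (2 * t)) - Real.exp (r * w / (2 * t))) * g w := by
    rcases lt_or_gt_of_ne hw with h | h
    · refine mul_pos (sub_pos.2 (Real.exp_lt_exp.2 ?_)) (hg.pos w h)
      gcongr ?_ / _
      nlinarith
    · refine mul_pos_of_neg_of_neg (sub_neg.2 (Real.exp_lt_exp.2 ?_)) (hg.neg w h)
      gcongr
  nlinarith [mul_pos he this]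

lemma Good.exists_neg (hg : Good g C) (t : ℝ) (ht : 0 < t) : ∃ s, H g s t < 0 := by
  set k : ℝ → ℝ := fun w => Real.exp (-(w ^ 2) / (4 * t)) * g w with hk
  have hki : Integrable k := by simpa using hg.int 0 t ht
  have hlim : Tendsto (fun s : ℝ => ∫ w, Real.exp (s * min w 0 / (2 * t)) * k w) atTop
      (𝓝 (∫ w, (Ici (0:ℝ)).indicator k w)) := by
    refine tendsto_integral_filter_of_dominated_convergence (fun w => ‖k w‖) ?_ ?_ hki.norm ?_
    · exact Eventually.of_forall fun s =>
        (Continuous.aestronglyMeasurable (by fun_prop)).mul hki.1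
    · filter_upwards [eventually_ge_atTop 0] with s hs
      refine ae_of_all _ fun w => ?_
      rw [norm_mul, Real.norm_eq_abs, Real.abs_exp]
      refine mul_le_of_le_one_left (norm_nonneg _) (Real.exp_le_one_iff.2 ?_)
      exact div_nonpos_of_nonpos_of_nonneg
        (mul_nonpos_of_nonneg_of_nonpos hs (min_le_right _ _)) (by positivity)
    · refine ae_of_all _ fun w => ?_
      by_cases hw : 0 ≤ w
      · simp [hw]
      · push Not at hw
        rw [indicator_of_notMem (by simpa using hw), min_eq_left hw.le]
        have h1 : Tendsto (fun s : ℝ => s * w / (2 * t)) atTop atBot :=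
          (tendsto_id.atTop_mul_const_of_neg hw).atBot_div_const (by positivity)
        simpa using (Real.tendsto_exp_atBot.comp h1).mul_const (k w)
  have hneg : ∫ w, (Ici (0:ℝ)).indicator k w < 0 := by
    rw [integral_indicator measurableSet_Ici, integral_Ici_eq_integral_Ioi, ← neg_pos,
      ← integral_neg, setIntegral_pos_iff_support_of_nonneg_ae]
    · refine lt_of_lt_of_le ?_ (measure_mono (s := Ioo (1:ℝ) 2) ?_)
      · simp
      · intro w hw
        have hw0 : 0 < w := by linarith [hw.1]
        exact ⟨neg_ne_zero.2 (mul_neg_of_pos_of_neg (Real.exp_pos _) (hg.neg w hw0)).ne, hw0⟩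
    · filter_upwards [ae_restrict_mem measurableSet_Ioi] with w hw
      exact neg_nonneg.2 (mul_neg_of_pos_of_neg (Real.exp_pos _) (hg.neg w hw)).le
    · exact hki.neg.integrableOn
  obtain ⟨s, hs, hs0⟩ := ((hlim.eventually (gt_mem_nhds hneg)).and (eventually_ge_atTop 0)).exists
  refine ⟨s, ?_⟩
  have h2 : Real.exp (s ^ 2 / (4 * t)) * H g s t ≤
      ∫ w, Real.exp (s * min w 0 / (2 * t)) * k w := by
    rw [H, ← integral_const_mul]
    refine integral_mono ((hg.int s t ht).const_mul _) ?_ ?_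
    · refine hki.norm.mono' ((Continuous.aestronglyMeasurable (by fun_prop)).mul hki.1)
        (ae_of_all _ fun w => ?_)
      rw [norm_mul, Real.norm_eq_abs, Real.abs_exp]
      refine mul_le_of_le_one_left (norm_nonneg _) (Real.exp_le_one_iff.2 ?_)
      exact div_nonpos_of_nonpos_of_nonneg
        (mul_nonpos_of_nonneg_of_nonpos hs0 (min_le_right _ _)) (by positivity)
    · intro w
      simp only
      rw [← mul_assoc, ker_split _ _ _ ht, mul_assoc]
      rcases le_or_gt w 0 with hw | hw
      · rw [min_eq_left hw]
      · rw [min_eq_right hw.le]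
        refine mul_le_mul_of_nonpos_right (Real.exp_le_exp.2 ?_)
          (mul_neg_of_pos_of_neg (Real.exp_pos _) (hg.neg w hw)).le
        gcongr
  by_contra hcon
  push Not at hcon
  have := mul_nonneg (Real.exp_pos (s ^ 2 / (4 * t))).le hcon
  linarith

lemma Good.small (hg : Good g C) (e : ℝ) (he : 0 < e) :
    ∀ᶠ t in 𝓝[>] (0:ℝ), H g e t < 0 := by
  have hgi : LocallyIntegrable g := by
    have hc : LocallyIntegrable (fun w : ℝ => C * (1 + |w|)) :=
      Continuous.locallyIntegrable (by fun_prop)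
    exact hc.mono hg.meas (ae_of_all _ fun w => (hg.bd w).trans (le_abs_self _))
  set J := Icc (e / 2) (3 * e / 2) with hJ
  have hJi : IntegrableOn g J := hgi.integrableOn_isCompact isCompact_Icc
  have hJi' : ∀ t, Integrable (J.indicator fun w => Real.exp (-(e ^ 2) / (16 * t)) * g w) :=
    fun t => IntegrableOn.integrable_indicator (hJi.const_mul _) measurableSet_Icc
  set c := -∫ w in J, g w with hc
  have hc0 : 0 < c := by
    rw [hc, ← integral_neg, setIntegral_pos_iff_support_of_nonneg_ae]
    · refine lt_of_lt_of_le ?_ (measure_mono (s := J) ?_)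
      · simp [hJ]; linarith
      · intro w hw
        exact ⟨neg_ne_zero.2 (hg.neg w (by linarith [hw.1])).ne, hw⟩
    · filter_upwards [ae_restrict_mem measurableSet_Icc] with w hw
      exact neg_nonneg.2 (hg.neg w (by linarith [hw.1])).le
    · exact hJi.neg
  set D := ∫ w : ℝ, Real.exp (-(1 / 4) * w ^ 2) * (C * (1 + |w|)) with hD
  have hDi := int_bd C (1 / 4) (by norm_num)
  have hlim : Tendsto (fun t : ℝ => Real.exp (-(3 * e ^ 2 / 16) * t⁻¹) * D - c) (𝓝[>] 0)
      (𝓝 (0 * D - c)) := by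
    have h1 : Tendsto (fun t : ℝ => -(3 * e ^ 2 / 16) * t⁻¹) (𝓝[>] 0) atBot :=
      tendsto_inv_nhdsGT_zero.const_mul_atTop_of_neg (by simp; positivity)
    exact ((Real.tendsto_exp_atBot.comp h1).mul_const D).sub_const c
  have hlt := hlim.eventually (gt_mem_nhds (show 0 * D - c < 0 by linarith))
  have hone : ∀ᶠ t in 𝓝[>] (0:ℝ), t < 1 := nhdsWithin_le_nhds (gt_mem_nhds one_pos)
  filter_upwards [hlt, hone, self_mem_nhdsWithin] with t h1 h2 h3
  replace h3 : 0 < t := h3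
  have key : H g e t ≤ Real.exp (-(e ^ 2) / (4 * t)) * D +
      Real.exp (-(e ^ 2) / (16 * t)) * ∫ w in J, g w := by
    rw [H, hD, ← integral_const_mul, ← integral_const_mul, ← integral_indicator measurableSet_Icc,
      ← integral_add (hDi.const_mul _) (hJi' t)]
    refine integral_mono (hg.int e t h3) ((hDi.const_mul _).add
      (hJi' t)) fun w => ?_
    simp only
    have hbnn : 0 ≤ C * (1 + |w|) := (abs_nonneg _).trans (hg.bd w)
    have hnn : 0 ≤ Real.exp (-(e ^ 2) / (4 * t)) *
      (Real.exp (-(1 / 4) * w ^ 2) * (C * (1 + |w|))) := by positivity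
    by_cases hw : w ∈ J
    · rw [indicator_of_mem hw]
      have : Real.exp (-((e - w) ^ 2) / (4 * t)) * g w ≤ Real.exp (-(e ^ 2) / (16 * t)) * g w := by
        refine mul_le_mul_of_nonpos_right (Real.exp_le_exp.2 ?_) (hg.neg w (by linarith [hw.1])).le
        rw [div_le_div_iff₀ (by positivity) (by positivity)]
        have : (e - w) ^ 2 ≤ (e / 2) ^ 2 := sq_le_sq' (by linarith [hw.2]) (by linarith [hw.1])
        nlinarith
      linarith
    · rw [indicator_of_notMem hw, add_zero]
      rcases le_or_gt w 0 with h0 | h0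
      · rw [← mul_assoc, ← Real.exp_add]
        refine (mul_le_mul_of_nonneg_left ((le_abs_self _).trans (hg.bd w))
          (Real.exp_pos _).le).trans (mul_le_mul_of_nonneg_right (Real.exp_le_exp.2 ?_) hbnn)
        · have : -((e - w) ^ 2) / (4 * t) ≤ (-(e ^ 2) - w ^ 2) / (4 * t) := by
            gcongr
            nlinarith
          have h5 : w ^ 2 / 4 ≤ w ^ 2 / (4 * t) := by
            gcongr
            linarith
          rw [sub_div] at this
          linarith
      · exact (mul_neg_of_pos_of_neg (Real.exp_pos _) (hg.neg w h0)).le.trans hnn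
  have h4 : Real.exp (-(e ^ 2) / (4 * t)) =
      Real.exp (-(e ^ 2) / (16 * t)) * Real.exp (-(3 * e ^ 2 / 16) * t⁻¹) := by
    rw [← Real.exp_add]
    congr 1
    field_simp
    ring
  rw [h4] at key
  have := mul_neg_of_pos_of_neg (Real.exp_pos (-(e ^ 2) / (16 * t))) h1
  have h6 : ∫ w in J, g w = -c := by rw [hc]; ring
  rw [h6] at key
  nlinarith

lemma Good.exists_zero (hg : Good g C) (t : ℝ) (ht : 0 < t) : ∃ s, H g s t = 0 := by
  obtain ⟨r, hr⟩ := hg.exists_neg t ht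
  obtain ⟨q, hq⟩ := hg.refl.exists_neg t ht
  rw [H_refl] at hq
  have hcont : Continuous fun s => H g s t := by
    rw [continuous_iff_continuousAt]
    intro s
    exact ContinuousAt.comp (f := fun s : ℝ => (s, t)) (hg.cont s t ht) (by fun_prop)
  exact mem_range_of_exists_le_of_exists_ge hcont ⟨r, hr.le⟩ ⟨-q, by linarith⟩

lemma Good.lt_of_neg (hg : Good g C) {t s r : ℝ} (ht : 0 < t) (hs : H g s t = 0) (hr : H g r t < 0) :
    s < r := by
  rw [← (hg.anti t ht).lt_iff_gt]
  simp only [hs, mul_zero]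
  exact mul_neg_of_pos_of_neg (Real.exp_pos _) hr

lemma Good.gt_of_pos (hg : Good g C) {t s r : ℝ} (ht : 0 < t) (hs : H g s t = 0) (hr : 0 < H g r t) :
    r < s := by
  rw [← (hg.anti t ht).lt_iff_gt]
  simp only [hs, mul_zero]
  exact mul_pos (Real.exp_pos _) hr

lemma Good.neg_of_gt (hg : Good g C) {t s r : ℝ} (ht : 0 < t) (hs : H g s t = 0) (hr : s < r) :
    H g r t < 0 := by
  have := hg.anti t ht hr
  simp only [hs, mul_zero] at this
  exact neg_of_mul_neg_right this (Real.exp_pos _).le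

lemma Good.pos_of_lt (hg : Good g C) {t s r : ℝ} (ht : 0 < t) (hs : H g s t = 0) (hr : r < s) :
    0 < H g r t := by
  have := hg.anti t ht hr
  simp only [hs, mul_zero] at this
  exact pos_of_mul_pos_right this (Real.exp_pos _).le

lemma Good.main (hg : Good g C) : ∃ p : ℝ → ℝ,
      (∀ t : ℝ, 0 < t → (H g (p t) t = 0 ∧ ∀ x : ℝ, H g x t = 0 → x = p t)) ∧
      ContinuousOn p (Set.Ioi (0 : ℝ)) ∧
      Filter.Tendsto p (nhdsWithin 0 (Set.Ioi (0 : ℝ))) (nhds 0) := by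
  have hex : ∀ t : ℝ, ∃ s, 0 < t → H g s t = 0 := fun t => by
    by_cases ht : 0 < t
    · obtain ⟨s, hs⟩ := hg.exists_zero t ht
      exact ⟨s, fun _ => hs⟩
    · exact ⟨0, fun h => absurd h ht⟩
  choose p hp using hex
  refine ⟨p, fun t ht => ⟨hp t ht, fun x hx => ?_⟩, ?_, ?_⟩
  · rcases lt_trichotomy x (p t) with h | h | h
    · exact absurd hx (hg.pos_of_lt ht (hp t ht) h).ne'
    · exact h
    · exact absurd hx (hg.neg_of_gt ht (hp t ht) h).ne
  · intro t ht
    apply ContinuousAt.continuousWithinAt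
    replace ht : 0 < t := ht
    have hc : ∀ r, ContinuousAt (fun t => H g r t) t := fun r =>
      ContinuousAt.comp (f := fun t : ℝ => (r, t)) (hg.cont r t ht) (by fun_prop)
    rw [ContinuousAt, tendsto_order]
    constructor
    · intro r hr
      filter_upwards [(hc r).eventually (lt_mem_nhds (hg.pos_of_lt ht (hp t ht) hr)),
        lt_mem_nhds ht] with u h1 h2
      exact hg.gt_of_pos h2 (hp u h2) h1
    · intro r hr
      filter_upwards [(hc r).eventually (gt_mem_nhds (hg.neg_of_gt ht (hp t ht) hr)),
        lt_mem_nhds ht] with u h1 h2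
      exact hg.lt_of_neg h2 (hp u h2) h1
  · rw [tendsto_order]
    constructor
    · intro r hr
      filter_upwards [hg.refl.small (-r) (by linarith), self_mem_nhdsWithin] with u h1 h2
      rw [H_refl, neg_neg, neg_lt_zero] at h1
      exact hg.gt_of_pos h2 (hp u h2) h1
    · intro r hr
      filter_upwards [hg.small r hr, self_mem_nhdsWithin] with u h1 h2
      exact hg.lt_of_neg h2 (hp u h2) h1

end FB

/-- Global existence of the free boundary: the heat extension `F` of the transformed datum
has, for each `t > 0`, exactly one zero `p(t)`; the resulting function `p` is continuous on
`(0,∞)` and `p(t) → p0` as `t → 0⁺`. -/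
theorem free_boundary_global_existence
    (f_I : ℝ → ℝ) (hint : Integrable f_I) (B : ℝ) (hB : ∀ x : ℝ, |f_I x| ≤ B)
    (p0 a : ℝ) (ha : 0 < a)
    (hA1_zero : f_I p0 = 0)
    (hA1_pos : ∀ x : ℝ, x < p0 → 0 < f_I x)
    (hA1_neg : ∀ x : ℝ, p0 < x → f_I x < 0)
    (F_I : ℝ → ℝ)
    (hFI_lt : ∀ x : ℝ, x < p0 → F_I x = ∑' n : ℕ, max (f_I (x + n * a)) 0)
    (hFI_gt : ∀ x : ℝ, p0 < x → F_I x = -∑' n : ℕ, max (-f_I (x - n * a)) 0)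
    (F : ℝ → ℝ → ℝ)
    (hF : ∀ x t : ℝ, F x t = ∫ z : ℝ, heatKernel t z * F_I (x - z)) :
    ∃ p : ℝ → ℝ,
      (∀ t : ℝ, 0 < t → (F (p t) t = 0 ∧ ∀ x : ℝ, F x t = 0 → x = p t)) ∧
      ContinuousOn p (Set.Ioi (0 : ℝ)) ∧
      Filter.Tendsto p (nhdsWithin 0 (Set.Ioi (0 : ℝ))) (nhds p0) := by
  have hm1 : AEMeasurable (fun w => f_I (p0 + w)) := hint.1.aemeasurable.comp_quasiMeasurePreserving
    (measurePreserving_add_left volume p0).quasiMeasurePreserving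
  have hm2 : AEMeasurable (fun w => -f_I (p0 - w)) :=
    (hint.1.aemeasurable.comp_quasiMeasurePreserving
      (Measure.measurePreserving_sub_left volume p0).quasiMeasurePreserving).neg
  obtain ⟨u1, u2, u3, u4⟩ := FB.series_facts _ hm1 B (fun x => hB _) 0 a ha (fun x hx => by
    rcases hx.eq_or_lt with h | h
    · simp [← h, hA1_zero]
    · exact (hA1_neg _ (by linarith)).le)
  obtain ⟨v1, v2, v3, v4⟩ := FB.series_facts _ hm2 B (fun x => by simpa using hB _) 0 a ha
    (fun x hx => by
    rcases hx.eq_or_lt with h | h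
    · simp [← h, hA1_zero]
    · simpa using (hA1_pos _ (by linarith)).le)
  set u : ℝ → ℝ := fun x => ∑' n : ℕ, max (f_I (p0 + (x + n * a))) 0 with hu
  set v : ℝ → ℝ := fun x => ∑' n : ℕ, max (-f_I (p0 - (x + n * a))) 0 with hv
  set g : ℝ → ℝ := fun w => u w - v (-w) with hgdef
  have hB0 : 0 ≤ B := (abs_nonneg _).trans (hB 0)
  have hbound : ∀ x : ℝ, B * (1 + |x| / a) ≤ B * (1 + 1 / a) * (1 + |x|) := fun x => by
    have : 1 + |x| / a ≤ (1 + 1 / a) * (1 + |x|) := by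
      have h1 : 0 ≤ 1 / a := by positivity
      have : (1 + 1 / a) * (1 + |x|) = 1 + |x| / a + (|x| + 1 / a) := by ring
      rw [this]
      linarith [abs_nonneg x]
    rw [mul_assoc]
    gcongr
  have hgood : FB.Good g (2 * (B * (1 + 1 / a))) := by
    refine ⟨?_, ?_, ?_, ?_⟩
    · exact (u1.sub (v1.comp_quasiMeasurePreserving
        (Measure.measurePreserving_neg volume).quasiMeasurePreserving)).aestronglyMeasurable
    · intro w
      have h1 := u2 w
      have h2 := v2 (-w)
      simp only [sub_zero, abs_neg] at h1 h2
      have h3 := hbound w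
      have : |g w| ≤ |u w| + |v (-w)| := abs_sub _ _
      have h1' : |u w| ≤ B * (1 + |w| / a) := h1
      have h2' : |v (-w)| ≤ B * (1 + |w| / a) := h2
      linarith
    · intro w hw
      have h1 : v (-w) = 0 := v3 (-w) (by linarith)
      have h2 : 0 < u w := u4 w (hA1_pos _ (by linarith))
      simp only [hgdef, h1]
      linarith
    · intro w hw
      have h1 : u w = 0 := u3 w hw.le
      have h2 : 0 < v (-w) := v4 (-w) (by simpa using hA1_neg (p0 + w) (by linarith))
      simp only [hgdef, h1]
      linarith
  have hgF : ∀ w, w ≠ 0 → F_I (p0 + w) = g w := by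
    intro w hw
    rcases lt_or_gt_of_ne hw with h | h
    · have h1 : v (-w) = 0 := v3 (-w) (by linarith)
      rw [hFI_lt _ (by linarith)]
      simp only [hgdef, h1, hu, sub_zero, add_assoc]
    · have h1 : u w = 0 := u3 w h.le
      rw [hFI_gt _ (by linarith)]
      simp only [hgdef, h1, hv, zero_sub]
      congr 2
      ext n
      congr 3
      ring
  have hFH : ∀ s t, F (p0 + s) t = (Real.sqrt (4 * Real.pi * t))⁻¹ * FB.H g s t := by
    intro s t
    rw [hF, FB.H, ← integral_const_mul, ← integral_sub_left_eq_self _ _ s]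
    have hae : ∀ᵐ w : ℝ, w ≠ 0 := by simp [ae_iff]
    refine integral_congr_ae ?_
    filter_upwards [hae] with w hw
    have : p0 + s - (s - w) = p0 + w := by ring
    rw [this, hgF w hw, heatKernel, mul_assoc]
  have hzero : ∀ s t, 0 < t → (F (p0 + s) t = 0 ↔ FB.H g s t = 0) := by
    intro s t ht
    have : 0 < (Real.sqrt (4 * Real.pi * t))⁻¹ := by positivity
    rw [hFH]
    simp only [mul_eq_zero, this.ne', false_or]
  obtain ⟨p, hp1, hp2, hp3⟩ := hgood.main
  refine ⟨fun t => p0 + p t, fun t ht => ⟨(hzero _ _ ht).2 (hp1 t ht).1, fun x hx => ?_⟩,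
    continuousOn_const.add hp2, by simpa using hp3.const_add p0⟩
  have h1 := (hp1 t ht).2 (x - p0) ((hzero _ _ ht).1 (by simpa using hx))
  linarith
end
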